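/- arXiv:2509.26631 — 2 statements merged into one kernel-verified Lean document; each statement's English description precedes it below -/
import Mathlib

section
/- Let D, M be positive natural numbers, let W_B, W_O : Matrix (Fin D) (Fin D) ℝ each satisfy the row-sum constraint (every row sums to 1), and let V : Fin M → Matrix (Fin D) (Fin 3) ℝ be a family of vector features. For each i : Fin M and channel d : Fin D define the score h(V)(i, d) = ∑ j, ((V i − W_O * (V i)) d j) * ((W_B * (V i) − W_O * (V i)) d j). Then the channel-wise argmax sets of the VN-Max pooling operation are SIM(3)-invariant: for every s : ℝ with 0 < s, every R : Matrix (Fin 3) (Fin 3) ℝ with R * Rᵀ = 1 and det R = 1, every t : Fin 3 → ℝ, and every channel d, writing g·(V i) = s • ((V i) * R) + T_D(t), the set {i : Fin M | ∀ i', h(fun k => g·(V k))(i', d) ≤ h(fun k => g·(V k))(i, d)} equals {i : Fin M | ∀ i', h(V)(i', d) ≤ h(V)(i, d)}. -/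
open Matrix

/-- The matrix with every row equal to `t`. -/
def Tmat (D : ℕ) (t : Fin 3 → ℝ) : Matrix (Fin D) (Fin 3) ℝ :=
  Matrix.of fun _ j => t j

/-- VN-Max score: channel-wise alignment of centered features with centered directions. -/
def vnMaxScore (D M : ℕ) (WB WO : Matrix (Fin D) (Fin D) ℝ)
    (V : Fin M → Matrix (Fin D) (Fin 3) ℝ) (i : Fin M) (d : Fin D) : ℝ :=
  ∑ j, ((V i - WO * V i) d j) * ((WB * V i - WO * V i) d j)

theorem mul_Tmat {D : ℕ} {W : Matrix (Fin D) (Fin D) ℝ} (hW : ∀ i, ∑ j, W i j = 1)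
    (t : Fin 3 → ℝ) : W * Tmat D t = Tmat D t := by
  ext d j
  simp [Tmat, Matrix.mul_apply, ← Finset.sum_mul, hW]

theorem vnMaxScore_eq_mul_transpose {D M : ℕ} (WB WO : Matrix (Fin D) (Fin D) ℝ)
    (V : Fin M → Matrix (Fin D) (Fin 3) ℝ) (i : Fin M) (d : Fin D) :
    vnMaxScore D M WB WO V i d = ((V i - WO * V i) * (WB * V i - WO * V i)ᵀ) d d := by
  simp only [vnMaxScore, Matrix.mul_apply (M := V i - WO * V i), Matrix.transpose_apply]

/-- The VN-Max score is invariant under rotations and translations and scales quadratically. -/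
theorem vnMaxScore_smul_mul_add_Tmat {D M : ℕ} {WB WO : Matrix (Fin D) (Fin D) ℝ}
    (hWB : ∀ i, ∑ j, WB i j = 1) (hWO : ∀ i, ∑ j, WO i j = 1)
    (V : Fin M → Matrix (Fin D) (Fin 3) ℝ) (s : ℝ)
    {R : Matrix (Fin 3) (Fin 3) ℝ} (hR : R * Rᵀ = 1) (t : Fin 3 → ℝ) (i : Fin M) (d : Fin D) :
    vnMaxScore D M WB WO (fun k => s • (V k * R) + Tmat D t) i d =
      s ^ 2 * vnMaxScore D M WB WO V i d := by
  have hA : s • (V i * R) + Tmat D t - WO * (s • (V i * R) + Tmat D t) =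
      s • ((V i - WO * V i) * R) := by
    rw [Matrix.mul_add, mul_Tmat hWO, add_sub_add_right_eq_sub, Matrix.mul_smul, ← smul_sub,
      Matrix.sub_mul, Matrix.mul_assoc]
  have hB : WB * (s • (V i * R) + Tmat D t) - WO * (s • (V i * R) + Tmat D t) =
      s • ((WB * V i - WO * V i) * R) := by
    rw [Matrix.mul_add, Matrix.mul_add, mul_Tmat hWB, mul_Tmat hWO, add_sub_add_right_eq_sub,
      Matrix.mul_smul, Matrix.mul_smul, ← smul_sub, Matrix.sub_mul, Matrix.mul_assoc,
      Matrix.mul_assoc]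
  have hAB (A B : Matrix (Fin D) (Fin 3) ℝ) :
      (s • (A * R)) * (s • (B * R))ᵀ = s ^ 2 • (A * Bᵀ) := by
    rw [Matrix.transpose_smul, Matrix.transpose_mul, Matrix.smul_mul, Matrix.mul_smul, smul_smul,
      Matrix.mul_assoc, ← Matrix.mul_assoc R, hR, Matrix.one_mul, sq]
  rw [vnMaxScore_eq_mul_transpose, vnMaxScore_eq_mul_transpose, hA, hB, hAB, Matrix.smul_apply,
    smul_eq_mul]

theorem vnMax_argmax_sim3_invariant
    (D M : ℕ) (hD : 0 < D) (hM : 0 < M)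
    (WB WO : Matrix (Fin D) (Fin D) ℝ)
    (hWB : ∀ i, ∑ j, WB i j = 1) (hWO : ∀ i, ∑ j, WO i j = 1)
    (V : Fin M → Matrix (Fin D) (Fin 3) ℝ)
    (s : ℝ) (hs : 0 < s)
    (R : Matrix (Fin 3) (Fin 3) ℝ) (hR : R * Rᵀ = 1) (hdet : R.det = 1)
    (t : Fin 3 → ℝ) (d : Fin D) :
    {i : Fin M | ∀ i',
        vnMaxScore D M WB WO (fun k => s • (V k * R) + Tmat D t) i' d ≤
          vnMaxScore D M WB WO (fun k => s • (V k * R) + Tmat D t) i d} =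
    {i : Fin M | ∀ i', vnMaxScore D M WB WO V i' d ≤ vnMaxScore D M WB WO V i d} := by
  ext i
  simp only [Set.mem_ofPred_eq, vnMaxScore_smul_mul_add_Tmat hWB hWO V s hR t,
    mul_le_mul_iff_right₀ (pow_pos hs 2)]
end

section
/- Let D, M be positive natural numbers, W_Q, W_K : Matrix (Fin D) (Fin D) ℝ, and let V : Fin M → Matrix (Fin D) (Fin 3) ℝ be a family of vector features such that for every i and every channel d the centered row of V i is nonzero, i.e. (fun j => (V i) d j − (1/D) ∑ d', (V i) d' j) ≠ 0. Let VNLN denote VN-LayerNorm as defined in the context, and define the canonicalized attention weights A(V) i j = softmax(fun j' => ⟨W_Q * VNLN(V i), W_K * VNLN(V j')⟩_F / Real.sqrt (3 * D)) j. Then A is SIM(3)-invariant: for every s : ℝ with 0 < s, every R : Matrix (Fin 3) (Fin 3) ℝ with R * Rᵀ = 1 and det R = 1, and every t : Fin 3 → ℝ, A(fun k => s • ((V k) * R) + T_D(t)) = A(V). -/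
open Matrix

/-- Layer normalization of a vector of channel magnitudes. -/
noncomputable def LN (D : ℕ) (u : Fin D → ℝ) : Fin D → ℝ :=
  fun d =>
    (u d - (1 / (D : ℝ)) * ∑ d', u d') /
      Real.sqrt ((1 / (D : ℝ)) * ∑ d', (u d' - (1 / (D : ℝ)) * ∑ d'', u d'') ^ 2)

/-- Channel mean of a vector feature. -/
noncomputable def chMean (D : ℕ) (V : Matrix (Fin D) (Fin 3) ℝ) : Fin 3 → ℝ :=
  fun j => (1 / (D : ℝ)) * ∑ d, V d j

/-- Row-wise norms of the centered vector feature. -/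
noncomputable def rowNorm (D : ℕ) (V : Matrix (Fin D) (Fin 3) ℝ) : Fin D → ℝ :=
  fun d => Real.sqrt (∑ j, (V d j - chMean D V j) ^ 2)

/-- VN-LayerNorm. -/
noncomputable def VNLN (D : ℕ) (V : Matrix (Fin D) (Fin 3) ℝ) :
    Matrix (Fin D) (Fin 3) ℝ :=
  Matrix.of fun d j => LN D (rowNorm D V) d * (V d j - chMean D V j) / rowNorm D V d

/-- Frobenius inner product of two matrices. -/
def frob {m n : ℕ} (A B : Matrix (Fin m) (Fin n) ℝ) : ℝ :=
  ∑ i, ∑ j, A i j * B i j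

/-- Softmax of a finite family of reals. -/
noncomputable def softmax (M : ℕ) (x : Fin M → ℝ) : Fin M → ℝ :=
  fun j => Real.exp (x j) / ∑ j', Real.exp (x j')

/-- Canonicalized attention weights: attention on VN-LayerNormed features. -/
noncomputable def canonAttn (D M : ℕ) (WQ WK : Matrix (Fin D) (Fin D) ℝ)
    (V : Fin M → Matrix (Fin D) (Fin 3) ℝ) (i : Fin M) : Fin M → ℝ :=
  softmax M (fun j' => frob (WQ * VNLN D (V i)) (WK * VNLN D (V j')) /
    Real.sqrt (3 * (D : ℝ)))

lemma LN_smul (D : ℕ) {s : ℝ} (hs : 0 < s) (u : Fin D → ℝ) :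
    LN D (fun d => s * u d) = LN D u := by
  have hmean : (1 / (D : ℝ)) * ∑ d, s * u d = s * ((1 / (D : ℝ)) * ∑ d, u d) := by
    rw [← Finset.mul_sum]; ring
  have hvar : Real.sqrt ((1 / (D : ℝ)) * ∑ d, (s * u d - s * ((1 / (D : ℝ)) * ∑ d', u d')) ^ 2) =
      s * Real.sqrt ((1 / (D : ℝ)) * ∑ d, (u d - (1 / (D : ℝ)) * ∑ d', u d') ^ 2) := by
    simp_rw [← mul_sub, mul_pow]
    rw [← Finset.mul_sum, mul_left_comm, Real.sqrt_mul (sq_nonneg s), Real.sqrt_sq hs.le]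
  funext d
  simp only [LN]
  rw [hmean, hvar, ← mul_sub, mul_div_mul_left _ _ hs.ne']

lemma frob_eq_trace {m n : ℕ} (A B : Matrix (Fin m) (Fin n) ℝ) :
    frob A B = (A * Bᵀ).trace := by
  simp [frob, Matrix.trace, Matrix.mul_apply]

lemma frob_mul_orthogonal {m n : ℕ} (A B : Matrix (Fin m) (Fin n) ℝ)
    {R : Matrix (Fin n) (Fin n) ℝ} (hR : R * Rᵀ = 1) :
    frob (A * R) (B * R) = frob A B := by
  rw [frob_eq_trace, frob_eq_trace, Matrix.transpose_mul, Matrix.mul_assoc,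
    ← Matrix.mul_assoc R, hR, Matrix.one_mul]

lemma sum_sq_vecMul_orthogonal {n : ℕ} (v : Fin n → ℝ)
    {R : Matrix (Fin n) (Fin n) ℝ} (hR : R * Rᵀ = 1) :
    ∑ j, (v ᵥ* R) j ^ 2 = ∑ j, v j ^ 2 := by
  have h : (v ᵥ* R) ⬝ᵥ (v ᵥ* R) = v ⬝ᵥ v := by
    rw [← Matrix.mulVec_transpose R v, Matrix.dotProduct_mulVec, Matrix.vecMul_transpose,
      Matrix.mulVec_mulVec, hR, Matrix.one_mulVec]
  simpa only [dotProduct, ← sq] using h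

lemma centered_similarity {D : ℕ} (hD : 0 < D) (V : Matrix (Fin D) (Fin 3) ℝ) (s : ℝ)
    (R : Matrix (Fin 3) (Fin 3) ℝ) (t : Fin 3 → ℝ) (d : Fin D) (j : Fin 3) :
    (s • (V * R) + Tmat D t) d j - chMean D (s • (V * R) + Tmat D t) j =
      s * ((fun k => V d k - chMean D V k) ᵥ* R) j := by
  have hD' : (D : ℝ) ≠ 0 := by exact_mod_cast hD.ne'
  simp only [chMean, Tmat, Matrix.add_apply, Matrix.smul_apply, Matrix.mul_apply, Matrix.of_apply,
    smul_eq_mul, Matrix.vecMul, dotProduct, Fin.sum_univ_three, Finset.sum_add_distrib,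
    ← Finset.mul_sum, ← Finset.sum_mul, Finset.sum_const, Finset.card_univ, Fintype.card_fin,
    nsmul_eq_mul]
  field_simp
  ring

lemma rowNorm_similarity {D : ℕ} (hD : 0 < D) (V : Matrix (Fin D) (Fin 3) ℝ)
    {s : ℝ} (hs : 0 < s) {R : Matrix (Fin 3) (Fin 3) ℝ} (hR : R * Rᵀ = 1) (t : Fin 3 → ℝ) :
    rowNorm D (s • (V * R) + Tmat D t) = fun d => s * rowNorm D V d := by
  funext d
  simp only [rowNorm]
  simp_rw [centered_similarity hD, mul_pow]
  rw [← Finset.mul_sum, sum_sq_vecMul_orthogonal _ hR, Real.sqrt_mul (sq_nonneg s),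
    Real.sqrt_sq hs.le]

lemma VNLN_similarity {D : ℕ} (hD : 0 < D) (V : Matrix (Fin D) (Fin 3) ℝ)
    {s : ℝ} (hs : 0 < s) {R : Matrix (Fin 3) (Fin 3) ℝ} (hR : R * Rᵀ = 1) (t : Fin 3 → ℝ) :
    VNLN D (s • (V * R) + Tmat D t) = VNLN D V * R := by
  ext d j
  simp only [VNLN, Matrix.of_apply, Matrix.mul_apply]
  rw [centered_similarity hD, rowNorm_similarity hD V hs hR, LN_smul D hs, mul_left_comm,
    mul_div_mul_left _ _ hs.ne']
  simp only [Matrix.vecMul, dotProduct, Finset.mul_sum, Finset.sum_div]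
  refine Finset.sum_congr rfl fun k _ => ?_
  ring

theorem canonical_attention_sim3_invariant
    (D M : ℕ) (hD : 0 < D) (hM : 0 < M)
    (WQ WK : Matrix (Fin D) (Fin D) ℝ)
    (V : Fin M → Matrix (Fin D) (Fin 3) ℝ)
    (hV : ∀ i d, (fun j => (V i) d j - chMean D (V i) j) ≠ 0)
    (s : ℝ) (hs : 0 < s)
    (R : Matrix (Fin 3) (Fin 3) ℝ) (hR : R * Rᵀ = 1) (hdet : R.det = 1)
    (t : Fin 3 → ℝ) :
    canonAttn D M WQ WK (fun k => s • (V k * R) + Tmat D t) =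
      canonAttn D M WQ WK V := by
  funext i
  simp only [canonAttn, VNLN_similarity hD _ hs hR, ← Matrix.mul_assoc, frob_mul_orthogonal _ _ hR]
end
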